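/- arXiv:2205.00596 — 2 statements merged into one kernel-verified Lean document; each statement's English description precedes it below -/
import Mathlib

section
/- Let w ∈ W have an Ṡ_n-admissible presentation w = τ_{k_1}^{i_{k_1}}·τ_{k_2}^{i_{k_2}}⋯τ_{k_m}^{i_{k_m}}. Then for every 1 ≤ j ≤ m, the index k_j belongs to the left descent set des(w) if and only if i_{k_j} < 0. -/
/-- The Coxeter matrix of type `Bₙ`, with the bond of order `4` between the
generators of indices `0` and `1` (the paper's convention): `s_i² = 1`,
`(s_0·s_1)⁴ = 1`, `(s_i·s_{i+1})³ = 1` for `1 ≤ i ≤ n-2`, and `(s_i·s_j)² = 1`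
for `|i-j| ≥ 2`. -/
def BCoxeterMatrix (n : ℕ) : CoxeterMatrix (Fin n) where
  M := Matrix.of fun i j : Fin n ↦
    if i = j then 1
      else if ((i : ℕ) = 0 ∧ (j : ℕ) = 1) ∨ ((j : ℕ) = 0 ∧ (i : ℕ) = 1) then 4
      else if (j : ℕ) + 1 = i ∨ (i : ℕ) + 1 = j then 3 else 2
  isSymm := by unfold Matrix.IsSymm; aesop
  diagonal := by simp
  off_diagonal := by aesop

variable {n : ℕ} {W : Type*} [Group W]

/-- The simple reflection `s_j` of the Coxeter system, for `0 ≤ j ≤ n-1`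
(junk value `1` for `j ≥ n`). -/
def sgen (cs : CoxeterSystem (BCoxeterMatrix n) W) (j : ℕ) : W :=
  if h : j < n then cs.simple ⟨j, h⟩ else 1

/-- `tau cs k` is the element `τ_k = s_0 · s_1 ⋯ s_{k-1}` (with `τ_0 = 1`). -/
def tau (cs : CoxeterSystem (BCoxeterMatrix n) W) (k : ℕ) : W :=
  ((List.range k).map (sgen cs)).prod

/-- An `Ṡ_n`-admissible presentation of `w ∈ W`: an expression
`w = τ_{k_1}^{i_{k_1}} ⋯ τ_{k_m}^{i_{k_m}}` with `1 ≤ k_1 < ⋯ < k_m ≤ n` and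
nonzero integers `i_{k_j}` such that `-k_j ≤ i_{k_j} ≤ k_j - 1` for all `j`,
`Σ_{j=1}^m i_{k_j} = 0`, and `0 ≤ Σ_{j=r}^m i_{k_j} ≤ k_{r-1}` for all `2 ≤ r ≤ m`. -/
structure IsAdmissible (cs : CoxeterSystem (BCoxeterMatrix n) W) (w : W)
    (m : ℕ) (k : Fin m → ℕ) (i : Fin m → ℤ) : Prop where
  one_le : ∀ j, 1 ≤ k j
  le_n : ∀ j, k j ≤ n
  mono : StrictMono k
  ne_zero : ∀ j, i j ≠ 0
  lb : ∀ j, -(k j : ℤ) ≤ i j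
  ub : ∀ j, i j ≤ (k j : ℤ) - 1
  total : ∑ j, i j = 0
  partialSum : ∀ r : ℕ, 1 ≤ r → ∀ hr : r < m,
    0 ≤ (∑ j ∈ Finset.univ.filter (fun j : Fin m => r ≤ (j : ℕ)), i j) ∧
    (∑ j ∈ Finset.univ.filter (fun j : Fin m => r ≤ (j : ℕ)), i j) ≤
      (k ⟨r - 1, Nat.lt_of_le_of_lt (Nat.sub_le r 1) hr⟩ : ℤ)
  prod_eq : w = ((List.finRange m).map (fun j => tau cs (k j) ^ i j)).prod

/-- `j ∈ des(w)`: the index `j` (with `0 ≤ j ≤ n-1`) is a left descent of `w`,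
i.e. `ℓ(s_j · w) < ℓ(w)`. -/
def IsDescentAt (cs : CoxeterSystem (BCoxeterMatrix n) W) (w : W) (j : ℕ) : Prop :=
  ∃ h : j < n, cs.IsLeftDescent w ⟨j, h⟩

/-- The smaller entry `-1` or `i` of the pair exchanged by the `i`-th generator. -/
def lowEntry (i : ℕ) : ℤ := if i = 0 then -1 else i

/-- The signed transposition exchanging `lowEntry i` with `i + 1` and their negatives. -/
def signedSwapFun (i : ℕ) (x : ℤ) : ℤ :=
  if x = lowEntry i then i + 1 else if x = i + 1 then lowEntry i
  else if x = -lowEntry i then -(i + 1) else if x = -(i + 1) then -lowEntry i else x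

theorem signedSwapFun_involutive (i : ℕ) : Function.Involutive (signedSwapFun i) := by
  intro x
  grind [signedSwapFun, lowEntry]

/-- `signedSwapFun` as a permutation of `ℤ`. -/
def signedSwap (i : ℕ) : Equiv.Perm ℤ := (signedSwapFun_involutive i).toPerm

theorem signedSwap_apply (i : ℕ) (x : ℤ) : signedSwap i x = signedSwapFun i x := rfl

theorem signedSwap_mul_self (i : ℕ) : signedSwap i * signedSwap i = 1 :=
  Equiv.ext (signedSwapFun_involutive i)

theorem signedSwap_neg (i : ℕ) (x : ℤ) : signedSwap i (-x) = -signedSwap i x := by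
  simp only [signedSwap_apply]
  grind [signedSwapFun, lowEntry]

theorem signedSwap_comm {i j : ℕ} (h : i + 1 < j) :
    signedSwap i * signedSwap j = signedSwap j * signedSwap i := by
  ext x
  simp only [Equiv.Perm.mul_apply, signedSwap_apply]
  grind (splits := 40) [signedSwapFun, lowEntry]

theorem signedSwap_braid {i : ℕ} (h : 1 ≤ i) :
    signedSwap i * signedSwap (i + 1) * signedSwap i =
      signedSwap (i + 1) * signedSwap i * signedSwap (i + 1) := by
  ext x
  simp only [Equiv.Perm.mul_apply, signedSwap_apply]
  grind (splits := 40) [signedSwapFun, lowEntry]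

theorem signedSwap_braid_zero :
    signedSwap 0 * signedSwap 1 * signedSwap 0 * signedSwap 1 =
      signedSwap 1 * signedSwap 0 * signedSwap 1 * signedSwap 0 := by
  ext x
  simp only [Equiv.Perm.mul_apply, signedSwap_apply]
  grind (splits := 40) [signedSwapFun, lowEntry]

theorem BCoxeterMatrix_apply (i j : Fin n) : BCoxeterMatrix n i j =
    if i = j then 1
      else if ((i : ℕ) = 0 ∧ (j : ℕ) = 1) ∨ ((j : ℕ) = 0 ∧ (i : ℕ) = 1) then 4
      else if (j : ℕ) + 1 = i ∨ (i : ℕ) + 1 = j then 3 else 2 := rfl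

section Involutions

variable {G : Type*} [Group G] {a b : G}

theorem mul_pow_two_eq_one_iff_comm (ha : a * a = 1) (hb : b * b = 1) :
    (a * b) ^ 2 = 1 ↔ a * b = b * a := by
  have ha' : a⁻¹ = a := inv_eq_of_mul_eq_one_left ha
  have hb' : b⁻¹ = b := inv_eq_of_mul_eq_one_left hb
  rw [pow_two, ← eq_inv_iff_mul_eq_one, mul_inv_rev, ha', hb']

theorem mul_pow_three_eq_one_iff_braid (ha : a * a = 1) (hb : b * b = 1) :
    (a * b) ^ 3 = 1 ↔ a * b * a = b * a * b := by
  have ha' : a⁻¹ = a := inv_eq_of_mul_eq_one_left ha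
  have hb' : b⁻¹ = b := inv_eq_of_mul_eq_one_left hb
  have : (a * b) ^ 3 = a * b * a * (b * a * b) := by
    simp only [pow_succ, pow_zero, one_mul, mul_assoc]
  rw [this, ← eq_inv_iff_mul_eq_one]
  simp only [mul_inv_rev, ha', hb', mul_assoc]

theorem mul_pow_four_eq_one_iff_braid (ha : a * a = 1) (hb : b * b = 1) :
    (a * b) ^ 4 = 1 ↔ a * b * a * b = b * a * b * a := by
  have ha' : a⁻¹ = a := inv_eq_of_mul_eq_one_left ha
  have hb' : b⁻¹ = b := inv_eq_of_mul_eq_one_left hb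
  have : (a * b) ^ 4 = a * b * a * b * (a * b * a * b) := by
    simp only [pow_succ, pow_zero, one_mul, mul_assoc]
  rw [this, ← eq_inv_iff_mul_eq_one]
  simp only [mul_inv_rev, ha', hb', mul_assoc]

end Involutions

theorem signedSwap_isLiftable :
    (BCoxeterMatrix n).IsLiftable fun i : Fin n => signedSwap i := by
  intro i j
  have hi := signedSwap_mul_self i
  have hj := signedSwap_mul_self j
  simp only [BCoxeterMatrix_apply]
  split_ifs with h₁ h₂ h₃
  · subst h₁
    rw [pow_one, hi]
  · rw [mul_pow_four_eq_one_iff_braid hi hj]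
    rcases h₂ with ⟨h, h'⟩ | ⟨h, h'⟩ <;> rw [h, h', signedSwap_braid_zero]
  · rw [mul_pow_three_eq_one_iff_braid hi hj]
    rcases h₃ with h | h
    · rw [← h, signedSwap_braid (by omega)]
    · rw [← h, signedSwap_braid (by omega)]
  · have h₄ : (i : ℕ) ≠ j := fun h => h₁ (Fin.ext h)
    rw [mul_pow_two_eq_one_iff_comm hi hj]
    rcases (by omega : (i : ℕ) + 1 < j ∨ (j : ℕ) + 1 < i) with h | h
    · exact signedSwap_comm h
    · exact (signedSwap_comm h).symm

/-- The representation of a Coxeter group of type `B` by signed permutations. -/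
def signedPerm (cs : CoxeterSystem (BCoxeterMatrix n) W) : W →* Equiv.Perm ℤ :=
  cs.lift ⟨fun i => signedSwap i, signedSwap_isLiftable⟩

section Generators

variable (cs : CoxeterSystem (BCoxeterMatrix n) W)

theorem signedPerm_simple (i : Fin n) : signedPerm cs (cs.simple i) = signedSwap i :=
  cs.lift_apply_simple signedSwap_isLiftable i

theorem sgen_of_lt {i : ℕ} (h : i < n) : sgen cs i = cs.simple ⟨i, h⟩ := dif_pos h

theorem signedPerm_sgen {i : ℕ} (h : i < n) : signedPerm cs (sgen cs i) = signedSwap i := by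
  rw [sgen_of_lt cs h, signedPerm_simple]

theorem sgen_mul_self (i : ℕ) : sgen cs i * sgen cs i = 1 := by
  unfold sgen
  split_ifs <;> simp

theorem sgen_comm {i j : ℕ} (h : i + 1 < j) :
    sgen cs i * sgen cs j = sgen cs j * sgen cs i := by
  rcases lt_or_ge j n with hj | hj
  · rw [← mul_pow_two_eq_one_iff_comm (sgen_mul_self cs i) (sgen_mul_self cs j),
      sgen_of_lt cs hj, sgen_of_lt cs (by omega : i < n)]
    convert cs.simple_mul_simple_pow _ _ using 2
    rw [BCoxeterMatrix_apply]
    simp only [Fin.ext_iff]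
    grind
  · simp [sgen, hj.not_gt]

theorem sgen_braid {i : ℕ} (h : 1 ≤ i) (hi : i + 1 < n) :
    sgen cs i * sgen cs (i + 1) * sgen cs i =
      sgen cs (i + 1) * sgen cs i * sgen cs (i + 1) := by
  rw [← mul_pow_three_eq_one_iff_braid (sgen_mul_self cs i) (sgen_mul_self cs _),
    sgen_of_lt cs hi, sgen_of_lt cs (by omega : i < n)]
  convert cs.simple_mul_simple_pow _ _ using 2
  rw [BCoxeterMatrix_apply]
  simp only [Fin.ext_iff]
  grind

theorem sgen_braid_zero (h : 1 < n) :
    sgen cs 0 * sgen cs 1 * sgen cs 0 * sgen cs 1 =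
      sgen cs 1 * sgen cs 0 * sgen cs 1 * sgen cs 0 := by
  rw [← mul_pow_four_eq_one_iff_braid (sgen_mul_self cs 0) (sgen_mul_self cs _),
    sgen_of_lt cs h, sgen_of_lt cs (by omega : 0 < n)]
  convert cs.simple_mul_simple_pow _ _ using 2
  rfl

end Generators

theorem signedPerm_neg (cs : CoxeterSystem (BCoxeterMatrix n) W) (w : W) (x : ℤ) :
    signedPerm cs w (-x) = -signedPerm cs w x := by
  induction w using cs.simple_induction_left generalizing x with
  | one => simp
  | mul_simple_left w i ih => simp [signedPerm_simple, ih, signedSwap_neg]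

theorem signedPerm_zero (cs : CoxeterSystem (BCoxeterMatrix n) W) (w : W) :
    signedPerm cs w 0 = 0 := by
  have := signedPerm_neg cs w 0
  rw [neg_zero] at this
  omega

theorem semiconj_signedSwap {f : ℤ → ℤ} (hf : Function.Injective f) (hneg : ∀ x, f (-x) = -f x)
    {i j : ℕ} (hlow : f (lowEntry i) = lowEntry j) (hhigh : f (i + 1) = j + 1) (x : ℤ) :
    f (signedSwap i x) = signedSwap j (f x) := by
  have h₁ := hneg (lowEntry i)
  have h₂ := hneg (i + 1)
  have h₃ := @hf x (lowEntry i)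
  have h₄ := @hf x (i + 1)
  have h₅ := @hf x (-lowEntry i)
  have h₆ := @hf x (-(i + 1))
  simp only [signedSwap_apply, signedSwapFun]
  split_ifs <;> grind

theorem semiconj_signedSwap_of_neg {f : ℤ → ℤ} (hf : Function.Injective f)
    (hneg : ∀ x, f (-x) = -f x) {i j : ℕ} (hlow : f (-(i + 1)) = lowEntry j)
    (hhigh : f (-lowEntry i) = j + 1) (x : ℤ) :
    f (signedSwap i x) = signedSwap j (f x) := by
  have h₁ := hneg (lowEntry i)
  have h₂ := hneg (i + 1)
  have h₃ := @hf x (lowEntry i)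
  have h₄ := @hf x (i + 1)
  have h₅ := @hf x (-lowEntry i)
  have h₆ := @hf x (-(i + 1))
  simp only [signedSwap_apply, signedSwapFun]
  split_ifs <;> grind

theorem eq_of_signedSwap_inversion {i : ℕ} {a b : ℤ} (ha : a ≠ 0) (hb : b ≠ 0) (hab : a < b)
    (h : signedSwap i b < signedSwap i a) :
    (a = lowEntry i ∧ b = i + 1) ∨ (a = -(i + 1) ∧ b = -lowEntry i) := by
  simp only [signedSwap_apply, signedSwapFun, lowEntry] at *
  split_ifs at * <;> omega

section CosetOrbit

variable (cs : CoxeterSystem (BCoxeterMatrix n) W) {X : Type*} [MulAction W X] (k : ℕ) (x₀ : X)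

/-- The point `s_y ⋯ s_k • x₀` of the orbit of `x₀`. -/
def posPoint (y : ℕ) : X := ((List.range' y (k + 1 - y)).map (sgen cs)).prod • x₀

/-- The point `s_{b-1} ⋯ s_1 · s_0 · s_1 ⋯ s_k • x₀` of the orbit of `x₀`. -/
def negPoint : ℕ → X
  | 0 => posPoint cs k x₀ 1
  | b + 1 => sgen cs b • negPoint b

/-- The common labelling of `posPoint` and `negPoint` by nonzero integers. -/
def orbitPoint (y : ℤ) : X :=
  if 0 < y then posPoint cs k x₀ y.toNat else negPoint cs k x₀ (-y).toNat

variable {k x₀}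

theorem posPoint_top : posPoint cs k x₀ (k + 1) = x₀ := by simp [posPoint]

theorem posPoint_eq_smul {y : ℕ} (h : y ≤ k) :
    posPoint cs k x₀ y = sgen cs y • posPoint cs k x₀ (y + 1) := by
  rw [posPoint, posPoint, show k + 1 - y = (k + 1 - (y + 1)) + 1 by omega, List.range'_succ]
  simp [mul_smul]

theorem sgen_smul_smul (i : ℕ) (x : X) : sgen cs i • sgen cs i • x = x := by
  rw [smul_smul, sgen_mul_self, one_smul]

theorem sgen_smul_comm {i j : ℕ} (h : i + 1 < j ∨ j + 1 < i) (x : X) :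
    sgen cs i • sgen cs j • x = sgen cs j • sgen cs i • x := by
  rw [smul_smul, smul_smul]
  rcases h with h | h
  · rw [sgen_comm cs h]
  · rw [sgen_comm cs h]

theorem sgen_smul_braid {i : ℕ} (h : 1 ≤ i) (hi : i + 1 < n) (x : X) :
    sgen cs i • sgen cs (i + 1) • sgen cs i • x =
      sgen cs (i + 1) • sgen cs i • sgen cs (i + 1) • x := by
  simp only [smul_smul, sgen_braid cs h hi, ← mul_assoc]

theorem sgen_smul_braid_zero (h : 1 < n) (x : X) :
    sgen cs 0 • sgen cs 1 • sgen cs 0 • sgen cs 1 • x =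
      sgen cs 1 • sgen cs 0 • sgen cs 1 • sgen cs 0 • x := by
  simp only [smul_smul, sgen_braid_zero cs h, ← mul_assoc]

theorem sgen_smul_posPoint_of_lt (hx : ∀ i < k, sgen cs i • x₀ = x₀) {i y : ℕ}
    (hi : i + 1 < y) (hy : y ≤ k + 1) : sgen cs i • posPoint cs k x₀ y = posPoint cs k x₀ y := by
  induction hy using Nat.decreasingInduction with
  | self => rw [posPoint_top, hx i (by omega)]
  | of_succ y hy ih =>
    rw [posPoint_eq_smul cs (by omega), sgen_smul_comm cs (.inl hi), ih (by omega)]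

theorem sgen_smul_posPoint_of_gt (hk : k < n) (hx : ∀ i < k, sgen cs i • x₀ = x₀) {i y : ℕ}
    (hy : 1 ≤ y) (hi : y < i) (hik : i ≤ k) :
    sgen cs i • posPoint cs k x₀ y = posPoint cs k x₀ y := by
  induction hi.le.trans hik using Nat.decreasingInduction with
  | self => omega
  | of_succ y hyk ih =>
    rcases (by omega : i = y + 1 ∨ y + 1 < i) with rfl | h
    · rw [posPoint_eq_smul cs (by omega), posPoint_eq_smul cs hik,
        ← sgen_smul_braid cs hy (by omega), sgen_smul_posPoint_of_lt cs hx (by omega) (by omega)]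
    · rw [posPoint_eq_smul cs (by omega), sgen_smul_comm cs (.inr h), ih (by omega) h]

theorem sgen_smul_negPoint_of_gt (hk : k < n) (hx : ∀ i < k, sgen cs i • x₀ = x₀) {i b : ℕ}
    (hb : 1 ≤ b) (hi : b < i) (hik : i ≤ k) :
    sgen cs i • negPoint cs k x₀ b = negPoint cs k x₀ b := by
  induction b, hb using Nat.le_induction with
  | base =>
    rw [negPoint, negPoint, sgen_smul_comm cs (.inr hi),
      sgen_smul_posPoint_of_gt cs hk hx le_rfl hi hik]
  | succ b hb ih => rw [negPoint, sgen_smul_comm cs (.inr hi), ih (by omega)]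

theorem sgen_smul_negPoint_of_lt (hk : k < n) (hx : ∀ i < k, sgen cs i • x₀ = x₀) {i b : ℕ}
    (hi : i + 1 < b) (hb : b ≤ k + 1) :
    sgen cs i • negPoint cs k x₀ b = negPoint cs k x₀ b := by
  induction b, hi using Nat.le_induction with
  | base =>
    rcases i.eq_zero_or_pos with rfl | h
    · rw [negPoint, negPoint, negPoint, posPoint_eq_smul cs (by omega),
        sgen_smul_braid_zero cs (by omega), sgen_smul_posPoint_of_lt cs hx (by omega) (by omega)]
    · rw [negPoint, negPoint, sgen_smul_braid cs h (by omega),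
        sgen_smul_negPoint_of_gt cs hk hx h (by omega) (by omega)]
  | succ b hib ih => rw [negPoint, sgen_smul_comm cs (.inl hib), ih (by omega)]

theorem orbitPoint_natCast {y : ℕ} (h : 1 ≤ y) :
    orbitPoint cs k x₀ y = posPoint cs k x₀ y := by
  rw [orbitPoint, if_pos (by omega), Int.toNat_natCast]

theorem orbitPoint_neg_natCast (b : ℕ) :
    orbitPoint cs k x₀ (-b) = negPoint cs k x₀ b := by
  rw [orbitPoint, if_neg (by omega), neg_neg, Int.toNat_natCast]

theorem signedSwap_ne_zero {i : ℕ} {y : ℤ} (hy : y ≠ 0) : signedSwap i y ≠ 0 := by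
  simp only [signedSwap_apply, signedSwapFun, lowEntry]
  split_ifs <;> omega

theorem abs_signedSwap_le {i k : ℕ} {y : ℤ} (hi : i ≤ k) (hy : |y| ≤ k + 1) :
    |signedSwap i y| ≤ k + 1 := by
  rw [abs_le] at *
  simp only [signedSwap_apply, signedSwapFun, lowEntry]
  split_ifs <;> omega

theorem sgen_smul_orbitPoint (hk : k < n) (hx : ∀ i < k, sgen cs i • x₀ = x₀) {i : ℕ} (hi : i ≤ k)
    {y : ℤ} (hy : y ≠ 0) (hyk : |y| ≤ k + 1) :
    sgen cs i • orbitPoint cs k x₀ y = orbitPoint cs k x₀ (signedSwap i y) := by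
  rw [abs_le] at hyk
  have hfix (h₁ : y ≠ lowEntry i) (h₂ : y ≠ i + 1) (h₃ : y ≠ -lowEntry i) (h₄ : y ≠ -(i + 1)) :
      signedSwap i y = y := by
    rw [signedSwap_apply, signedSwapFun, if_neg h₁, if_neg h₂, if_neg h₃, if_neg h₄]
  obtain ⟨b, rfl | rfl⟩ := y.eq_nat_or_neg
  · rw [orbitPoint_natCast cs (by omega)]
    rcases (by omega : i + 1 < b ∨ i + 1 = b ∨ i = b ∨ b < i) with h | h | h | h
    · rw [hfix, orbitPoint_natCast cs (by omega), sgen_smul_posPoint_of_lt cs hx h (by omega)]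
      all_goals grind [lowEntry]
    · subst h
      rcases i.eq_zero_or_pos with rfl | h
      · rw [show signedSwap 0 ((0 + 1 : ℕ) : ℤ) = -(1 : ℕ) from rfl, orbitPoint_neg_natCast]
        rfl
      · rw [show signedSwap i ((i + 1 : ℕ) : ℤ) = i by
            grind [signedSwap_apply, signedSwapFun, lowEntry],
          orbitPoint_natCast cs h, posPoint_eq_smul cs hi]
    · subst h
      rw [show signedSwap i (i : ℤ) = (i + 1 : ℕ) by
          grind [signedSwap_apply, signedSwapFun, lowEntry],
        orbitPoint_natCast cs (by omega), posPoint_eq_smul cs hi, sgen_smul_smul]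
    · rw [hfix, orbitPoint_natCast cs (by omega), sgen_smul_posPoint_of_gt cs hk hx (by omega) h hi]
      all_goals grind [lowEntry]
  · rw [orbitPoint_neg_natCast cs]
    rcases (by omega : i + 1 < b ∨ i + 1 = b ∨ i = b ∨ b < i) with h | h | h | h
    · rw [hfix, orbitPoint_neg_natCast cs, sgen_smul_negPoint_of_lt cs hk hx h (by omega)]
      all_goals grind [lowEntry]
    · subst h
      rcases i.eq_zero_or_pos with rfl | h
      · rw [show signedSwap 0 (-((0 + 1 : ℕ) : ℤ)) = (1 : ℕ) from rfl, orbitPoint_natCast cs le_rfl]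
        exact sgen_smul_smul cs 0 _
      · rw [show signedSwap i (-((i + 1 : ℕ) : ℤ)) = -i by
            grind [signedSwap_apply, signedSwapFun, lowEntry],
          orbitPoint_neg_natCast, negPoint, sgen_smul_smul]
    · subst h
      rw [show signedSwap i (-(i : ℤ)) = -(i + 1 : ℕ) by
          grind [signedSwap_apply, signedSwapFun, lowEntry], orbitPoint_neg_natCast]
      rfl
    · rw [hfix, orbitPoint_neg_natCast cs,
        sgen_smul_negPoint_of_gt cs hk hx (by omega) h hi]
      all_goals grind [lowEntry]

end CosetOrbit

/-- The standard parabolic subgroup generated by `s_0, …, s_{k-1}`. -/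
def initialParabolic (cs : CoxeterSystem (BCoxeterMatrix n) W) (k : ℕ) : Subgroup W :=
  Subgroup.closure (sgen cs '' Set.Iio k)

theorem smul_orbitPoint_of_mem (cs : CoxeterSystem (BCoxeterMatrix n) W) {X : Type*} [MulAction W X]
    {k : ℕ} {x₀ : X} (hk : k < n) (hx : ∀ i < k, sgen cs i • x₀ = x₀) {w : W}
    (hw : w ∈ initialParabolic cs (k + 1)) :
    ∀ y : ℤ, y ≠ 0 → |y| ≤ k + 1 →
      w • orbitPoint cs k x₀ y = orbitPoint cs k x₀ (signedPerm cs w y) ∧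
        signedPerm cs w y ≠ 0 ∧ |signedPerm cs w y| ≤ k + 1 := by
  have hmul {i : ℕ} (hi : i < k + 1) {w : W} {y : ℤ}
      (h : w • orbitPoint cs k x₀ y = orbitPoint cs k x₀ (signedPerm cs w y) ∧
        signedPerm cs w y ≠ 0 ∧ |signedPerm cs w y| ≤ k + 1) :
      (sgen cs i * w) • orbitPoint cs k x₀ y =
          orbitPoint cs k x₀ (signedPerm cs (sgen cs i * w) y) ∧
        signedPerm cs (sgen cs i * w) y ≠ 0 ∧ |signedPerm cs (sgen cs i * w) y| ≤ k + 1 := by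
    obtain ⟨h₁, h₂, h₃⟩ := h
    rw [map_mul, Equiv.Perm.mul_apply, signedPerm_sgen cs (by omega), mul_smul, h₁,
      sgen_smul_orbitPoint cs hk hx (by omega) h₂ h₃]
    exact ⟨rfl, signedSwap_ne_zero h₂, abs_signedSwap_le (by omega) h₃⟩
  intro y hy hyk
  induction hw using Subgroup.closure_induction_left with
  | one => simp [hy, hyk]
  | mul_left x hx' w _ ih =>
    obtain ⟨i, hi, rfl⟩ := hx'
    exact hmul hi ih
  | inv_mul_cancel x hx' w _ ih =>
    obtain ⟨i, hi, rfl⟩ := hx'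
    rw [inv_eq_of_mul_eq_one_left (sgen_mul_self cs i)]
    exact hmul hi ih

theorem eq_one_of_mem_initialParabolic (cs : CoxeterSystem (BCoxeterMatrix n) W) {k : ℕ}
    (hk : k ≤ n) {w : W} (hw : w ∈ initialParabolic cs k) (h : signedPerm cs w = 1) : w = 1 := by
  induction k with
  | zero => simpa [initialParabolic] using hw
  | succ k ih =>
    have hx (i : ℕ) (hi : i < k) : sgen cs i • ((1 : W) : W ⧸ initialParabolic cs k) = (1 : W) := by
      have hmem : sgen cs i ∈ initialParabolic cs k :=
        Subgroup.subset_closure (Set.mem_image_of_mem _ hi)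
      rw [MulAction.Quotient.smul_coe, eq_comm, QuotientGroup.eq]
      simpa using hmem
    have hfix := (smul_orbitPoint_of_mem cs hk hx hw (k + 1 : ℕ) (by omega)
      (by rw [abs_le]; omega)).1
    rw [h, Equiv.Perm.one_apply, orbitPoint_natCast cs (by omega), posPoint_top] at hfix
    rw [MulAction.Quotient.smul_coe, eq_comm, QuotientGroup.eq] at hfix
    exact ih (by omega) (by simpa using hfix)

theorem signedPerm_injective (cs : CoxeterSystem (BCoxeterMatrix n) W) :
    Function.Injective (signedPerm cs) := by
  refine (injective_iff_map_eq_one _).2 fun w hw => eq_one_of_mem_initialParabolic cs le_rfl ?_ hw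
  rw [initialParabolic, show sgen cs '' Set.Iio n = Set.range cs.simple from ?_,
    cs.subgroup_closure_range_simple]
  · trivial
  · ext x
    constructor
    · rintro ⟨i, hi, rfl⟩
      exact ⟨⟨i, hi⟩, (sgen_of_lt cs hi).symm⟩
    · rintro ⟨i, rfl⟩
      exact ⟨i, i.2, sgen_of_lt cs i.2⟩

theorem lowEntry_ne_zero (i : ℕ) : lowEntry i ≠ 0 := by
  unfold lowEntry
  split_ifs <;> omega

theorem succ_ne_lowEntry (i : ℕ) : (i : ℤ) + 1 ≠ lowEntry i := by
  unfold lowEntry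
  split_ifs <;> omega

section Descents

variable (cs : CoxeterSystem (BCoxeterMatrix n) W)

theorem signedPerm_ne_zero (w : W) {x : ℤ} (hx : x ≠ 0) : signedPerm cs w x ≠ 0 := by
  rwa [← signedPerm_zero cs w, (signedPerm cs w).injective.ne_iff]

theorem mul_simple_eq_simple_mul {w : W} {i j : Fin n}
    (h : ∀ x, signedPerm cs w (signedSwap i x) = signedSwap j (signedPerm cs w x)) :
    w * cs.simple i = cs.simple j * w := by
  apply signedPerm_injective cs
  ext x
  simp [signedPerm_simple, h]

theorem exists_shorter_word (ω : List (Fin n)) (j : Fin n)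
    (h : signedPerm cs (cs.wordProd ω)⁻¹ (j + 1) <
      signedPerm cs (cs.wordProd ω)⁻¹ (lowEntry j)) :
    ∃ ω' : List (Fin n), ω'.length + 1 = ω.length ∧
      cs.wordProd ω' = cs.simple j * cs.wordProd ω := by
  induction ω using List.reverseRecOn with
  | nil =>
    simp only [CoxeterSystem.wordProd_nil, inv_one, map_one, Equiv.Perm.one_apply, lowEntry] at h
    split_ifs at h <;> omega
  | append_singleton ω i ih =>
    rw [cs.wordProd_append, cs.wordProd_singleton] at *
    set w := cs.wordProd ω with hw
    rcases lt_or_gt_of_ne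
      ((signedPerm cs w⁻¹).injective.ne (succ_ne_lowEntry j)) with hlt | hgt
    · obtain ⟨ω', hlen, hprod⟩ := ih hlt
      exact ⟨ω' ++ [i], by simpa using hlen, by
        rw [cs.wordProd_append, cs.wordProd_singleton, hprod, mul_assoc]⟩
    · rw [mul_inv_rev, cs.inv_simple, map_mul, Equiv.Perm.mul_apply, Equiv.Perm.mul_apply,
        signedPerm_simple] at h
      have happly (x : ℤ) : signedPerm cs w (signedPerm cs w⁻¹ x) = x := by
        rw [← Equiv.Perm.mul_apply, ← map_mul, mul_inv_cancel, map_one, Equiv.Perm.one_apply]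
      have hconj : w * cs.simple i = cs.simple j * w := by
        apply mul_simple_eq_simple_mul
        rcases eq_of_signedSwap_inversion (signedPerm_ne_zero cs _ (lowEntry_ne_zero j))
          (signedPerm_ne_zero cs _ (by omega)) hgt h with ⟨h₁, h₂⟩ | ⟨h₁, h₂⟩
        · exact semiconj_signedSwap (signedPerm cs w).injective (signedPerm_neg cs w)
            (by rw [← h₁, happly]) (by rw [← h₂, happly])
        · exact semiconj_signedSwap_of_neg (signedPerm cs w).injective (signedPerm_neg cs w)
            (by rw [← h₁, happly]) (by rw [← h₂, happly])
      exact ⟨ω, by simp, by rw [hconj, cs.simple_mul_simple_cancel_left]⟩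

theorem isLeftDescent_of_signedPerm_lt {w : W} {j : Fin n}
    (h : signedPerm cs w⁻¹ (j + 1) < signedPerm cs w⁻¹ (lowEntry j)) : cs.IsLeftDescent w j := by
  obtain ⟨ω, hω, rfl⟩ := cs.exists_isReduced w
  obtain ⟨ω', hlen, hprod⟩ := exists_shorter_word cs ω j h
  have := cs.length_wordProd_le ω'
  rw [CoxeterSystem.IsLeftDescent, ← hprod, hω.eq]
  omega

theorem isLeftDescent_iff_signedPerm_lt {w : W} {j : Fin n} :
    cs.IsLeftDescent w j ↔ signedPerm cs w⁻¹ (j + 1) < signedPerm cs w⁻¹ (lowEntry j) := by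
  refine ⟨fun h => ?_, isLeftDescent_of_signedPerm_lt cs⟩
  by_contra hlt
  rw [cs.isLeftDescent_iff_not_isLeftDescent_mul] at h
  apply h
  apply isLeftDescent_of_signedPerm_lt
  have hne := (signedPerm cs w⁻¹).injective.ne (succ_ne_lowEntry j)
  have h₁ : signedSwap j (lowEntry j) = j + 1 := if_pos rfl
  have h₂ : signedSwap j (j + 1) = lowEntry j := by
    rw [← h₁]
    exact signedSwapFun_involutive j _
  rw [mul_inv_rev, cs.inv_simple, map_mul, Equiv.Perm.mul_apply, Equiv.Perm.mul_apply,
    signedPerm_simple, h₁, h₂]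
  omega

end Descents

/-- The signed rotation `1 ↦ 2 ↦ ⋯ ↦ k ↦ -1 ↦ -2 ↦ ⋯ ↦ -k ↦ 1`, the image of `τ_k`. -/
def signedRot (k : ℕ) : Equiv.Perm ℤ := ((List.range k).map signedSwap).prod

theorem signedRot_succ (k : ℕ) : signedRot (k + 1) = signedRot k * signedSwap k := by
  simp [signedRot, List.range_succ]

theorem signedRot_neg (k : ℕ) (x : ℤ) : signedRot k (-x) = -signedRot k x := by
  induction k generalizing x with
  | zero => rfl
  | succ k ih => simp [signedRot_succ, signedSwap_neg, ih]

theorem signedRot_of_gt {k : ℕ} {x : ℤ} (h : (k : ℤ) < x) : signedRot k x = x := by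
  induction k with
  | zero => rfl
  | succ k ih =>
    rw [signedRot_succ, Equiv.Perm.mul_apply, show signedSwap k x = x from ?_, ih (by omega)]
    simp only [signedSwap_apply, signedSwapFun, lowEntry]
    split_ifs <;> omega

theorem signedRot_self {k : ℕ} (hk : 1 ≤ k) : signedRot k k = -1 := by
  induction k, hk using Nat.le_induction with
  | base => rfl
  | succ k hk ih =>
    rw [signedRot_succ, Equiv.Perm.mul_apply, show signedSwap k (k + 1 : ℕ) = k from ?_, ih]
    simp only [signedSwap_apply, signedSwapFun, lowEntry]
    split_ifs <;> omega

theorem signedRot_of_lt {k : ℕ} {x : ℤ} (hx : 1 ≤ x) (h : x < k) : signedRot k x = x + 1 := by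
  induction k with
  | zero => omega
  | succ k ih =>
    rw [signedRot_succ, Equiv.Perm.mul_apply]
    rcases (by omega : x = k ∨ x < k) with rfl | hlt
    · rw [show signedSwap k k = (k : ℤ) + 1 from ?_, signedRot_of_gt (by omega)]
      simp only [signedSwap_apply, signedSwapFun, lowEntry]
      split_ifs <;> omega
    · rw [show signedSwap k x = x from ?_, ih hlt]
      simp only [signedSwap_apply, signedSwapFun, lowEntry]
      split_ifs <;> omega

theorem signedRot_zpow_of_gt {k : ℕ} {x : ℤ} (h : (k : ℤ) < x) (i : ℤ) :
    (signedRot k ^ i) x = x := by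
  have : signedRot k ∈ MulAction.stabilizer (Equiv.Perm ℤ) x := signedRot_of_gt h
  exact zpow_mem this i

theorem signedRot_zpow_apply {k : ℕ} {x p : ℤ} (hx : 1 ≤ x) (hxk : x ≤ k) (hp : 0 ≤ p)
    (hpk : p ≤ k) :
    (signedRot k ^ p) x = if x + p ≤ k then x + p else -(x + p - k) := by
  lift p to ℕ using hp
  rw [zpow_natCast]
  induction p with
  | zero => simp [hxk]
  | succ p ih =>
    rw [pow_succ', Equiv.Perm.mul_apply, ih (by omega)]
    push_cast at *
    rcases lt_trichotomy (x + p) (k : ℤ) with h | h | h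
    · rw [if_pos h.le, if_pos (by omega), signedRot_of_lt (by omega) h, add_assoc]
    · rw [if_pos h.le, if_neg (by omega), h, signedRot_self (by omega)]
      omega
    · rw [if_neg (by omega), if_neg (by omega), signedRot_neg, signedRot_of_lt (by omega) (by omega)]
      omega

theorem signedRot_zpow_apply_of_le {c K : ℕ} {x p : ℤ} (hx : 1 ≤ x) (hxc : x ≤ c) (hp : 0 ≤ p)
    (hpc : p ≤ c) (hcK : c ≤ K) :
    (signedRot c ^ p) x = (signedRot K ^ p) (if x + p ≤ c then x else x + K - c) := by
  split_ifs with h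
  · rw [signedRot_zpow_apply hx hxc hp hpc, signedRot_zpow_apply hx (by omega) hp (by omega),
      if_pos h, if_pos (by omega)]
  · rw [signedRot_zpow_apply hx hxc hp hpc, signedRot_zpow_apply (by omega) (by omega) hp (by omega),
      if_neg h, if_neg (by omega)]
    omega

theorem strictMonoOn_comp_signedRot {F : Equiv.Perm ℤ} {c K : ℕ} {i p p' : ℤ} (hp : p = i + p')
    (hp₀ : 0 ≤ p) (hpc : p ≤ c) (hcK : c ≤ K) (hp'₀ : 0 ≤ p') (hp'K : p' ≤ K)
    (hF : StrictMonoOn (fun x => F ((signedRot (K + 1) ^ p') x)) (Set.Icc 1 (K + 1))) :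
    StrictMonoOn (fun x => F ((signedRot K ^ (-i)) ((signedRot c ^ p) x))) (Set.Icc 1 c) := by
  have key {x : ℤ} (hx : x ∈ Set.Icc 1 (c : ℤ)) : ∃ y ∈ Set.Icc 1 (K : ℤ),
      y = (if x + p ≤ c then x else x + K - c) ∧
      (signedRot K ^ (-i)) ((signedRot c ^ p) x) =
        (signedRot (K + 1) ^ p') (if y + p' ≤ K then y else y + 1) := by
    obtain ⟨hx₁, hxc⟩ := hx
    refine ⟨_, ?_, rfl, ?_⟩
    · constructor <;> split_ifs <;> omega
    · rw [signedRot_zpow_apply_of_le hx₁ hxc hp₀ hpc hcK, ← Equiv.Perm.mul_apply, ← zpow_add,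
        show -i + p = p' by omega, signedRot_zpow_apply_of_le (c := K) (K := K + 1) _ _ hp'₀ hp'K]
      · push_cast
        congr 2
        omega
      · omega
      · split_ifs <;> omega
      · split_ifs <;> omega
  intro x hx x' hx' hlt
  obtain ⟨y, hy, hyx, h⟩ := key hx
  obtain ⟨y', hy', hyx', h'⟩ := key hx'
  simp only [Set.mem_Icc] at *
  simp only [h, h']
  have hlt' : y < y' := by
    rw [hyx, hyx']
    split_ifs <;> omega
  refine hF ?_ ?_ ?_
  · constructor <;> split_ifs <;> omega
  · constructor <;> split_ifs <;> omega
  · split_ifs <;> omega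

section Tails

variable {m : ℕ}

/-- The product of the terms of index at least `r`. -/
def tailProd {G : Type*} [Group G] (f : Fin m → G) (r : ℕ) : G :=
  (((List.finRange m).drop r).map f).prod

theorem tailProd_of_ge {G : Type*} [Group G] (f : Fin m → G) {r : ℕ} (h : m ≤ r) :
    tailProd f r = 1 := by
  simp [tailProd, List.drop_eq_nil_of_le, h]

theorem tailProd_eq_mul {G : Type*} [Group G] (f : Fin m → G) (r : Fin m) :
    tailProd f r = f r * tailProd f (r + 1) := by
  rw [tailProd, List.drop_eq_getElem_cons (by simp)]
  simp [tailProd]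

/-- The sum of the terms of index at least `r`. -/
def tailSum (i : Fin m → ℤ) (r : ℕ) : ℤ :=
  ∑ j ∈ Finset.univ.filter (fun j : Fin m => r ≤ (j : ℕ)), i j

theorem tailSum_of_ge (i : Fin m → ℤ) {r : ℕ} (h : m ≤ r) : tailSum i r = 0 := by
  refine Finset.sum_eq_zero fun j hj => ?_
  have := (Finset.mem_filter.1 hj).2
  omega

theorem tailSum_eq_add (i : Fin m → ℤ) (r : Fin m) :
    tailSum i r = i r + tailSum i (r + 1) := by
  rw [tailSum, tailSum, ← Finset.sum_insert (by simp)]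
  congr 1
  ext j
  simp only [Finset.mem_filter, Finset.mem_univ, true_and, Finset.mem_insert, Fin.ext_iff]
  omega

end Tails

section Admissible

variable {cs : CoxeterSystem (BCoxeterMatrix n) W} {w : W} {m : ℕ} {k : Fin m → ℕ} {i : Fin m → ℤ}

theorem IsAdmissible.tailSum_succ_mem (h : IsAdmissible cs w m k i) (j : Fin m) :
    0 ≤ tailSum i (j + 1) ∧ tailSum i (j + 1) ≤ k j := by
  rcases lt_or_ge ((j : ℕ) + 1) m with hj | hj
  · exact h.partialSum (j + 1) (by omega) hj
  · rw [tailSum_of_ge i hj]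
    omega

theorem IsAdmissible.tailSum_mem (h : IsAdmissible cs w m k i) (j : Fin m) :
    0 ≤ tailSum i j ∧ tailSum i j < k j := by
  obtain ⟨j, hj⟩ := j
  have hk := h.one_le ⟨j, hj⟩
  rcases j with _ | j
  · have : tailSum i 0 = 0 := by simpa [tailSum] using h.total
    rw [this]
    omega
  · have hmem := h.tailSum_succ_mem ⟨j, by omega⟩
    have hmono := h.mono (a := ⟨j, by omega⟩) (b := ⟨j + 1, hj⟩) (Fin.mk_lt_mk.2 (by omega))
    simp only at *
    omega

theorem IsAdmissible.strictMonoOn (h : IsAdmissible cs w m k i) (j : Fin m) :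
    StrictMonoOn (fun x => (tailProd (fun l => signedRot (k l) ^ i l) (j + 1))⁻¹
      ((signedRot (k j + 1) ^ tailSum i (j + 1)) x)) (Set.Icc 1 (k j + 1)) := by
  obtain ⟨j, hj⟩ := j
  induction (by omega : j ≤ m - 1) using Nat.decreasingInduction with
  | self =>
    rw [tailProd_of_ge _ (by simp only; omega), tailSum_of_ge _ (by simp only; omega)]
    simp [StrictMonoOn]
  | of_succ j hj' ih =>
    have hj₁ : j + 1 < m := by omega
    have hprod := tailProd_eq_mul (fun l => signedRot (k l) ^ i l) ⟨j + 1, hj₁⟩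
    have hsum := tailSum_eq_add i ⟨j + 1, hj₁⟩
    have hmem := h.tailSum_succ_mem ⟨j, hj⟩
    have hmem' := h.tailSum_succ_mem ⟨j + 1, hj₁⟩
    have hmono := h.mono (a := ⟨j, hj⟩) (b := ⟨j + 1, hj₁⟩) (Fin.mk_lt_mk.2 (by omega))
    have := strictMonoOn_comp_signedRot (c := k ⟨j, hj⟩ + 1) hsum hmem.1
      (by push_cast; exact hmem.2.trans (by omega)) hmono hmem'.1 hmem'.2 (ih hj₁)
    simp only at *
    rw [hprod, mul_inv_rev, ← zpow_neg]
    exact_mod_cast this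

theorem signedPerm_tau (cs : CoxeterSystem (BCoxeterMatrix n) W) {k : ℕ} (hk : k ≤ n) :
    signedPerm cs (tau cs k) = signedRot k := by
  rw [tau, map_list_prod, List.map_map, signedRot]
  congr 1
  refine List.map_congr_left fun i hi => ?_
  exact signedPerm_sgen cs (by rw [List.mem_range] at hi; omega)

theorem IsAdmissible.signedPerm_inv_apply (h : IsAdmissible cs w m k i) (j : Fin m) {x : ℤ}
    (hx : (k j : ℤ) ≤ x) :
    signedPerm cs w⁻¹ x = (tailProd (fun l => signedRot (k l) ^ i l) (j + 1))⁻¹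
      ((signedRot (k j) ^ (-i j)) x) := by
  have hw : signedPerm cs w = ((List.finRange m).map fun l => signedRot (k l) ^ i l).prod := by
    rw [h.prod_eq, map_list_prod, List.map_map]
    congr 2
    ext1 l
    rw [Function.comp_apply, map_zpow, signedPerm_tau cs (h.le_n l)]
  have hfix : (((List.finRange m).take j).map fun l => signedRot (k l) ^ i l).prod ∈
      MulAction.stabilizer (Equiv.Perm ℤ) x := by
    refine Subgroup.list_prod_mem _ fun g hg => ?_
    obtain ⟨l, hl, rfl⟩ := List.mem_map.1 hg
    obtain ⟨a, ha, rfl⟩ := List.mem_take_iff_getElem.1 hl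
    have hlt : k ((List.finRange m)[a]) < k j := h.mono (by
      rw [Fin.lt_def]
      simp only [List.getElem_finRange, Fin.val_cast]
      omega)
    exact signedRot_zpow_of_gt (by omega) _
  rw [← List.take_append_drop j (List.finRange m), List.map_append, List.prod_append] at hw
  change _ = _ * tailProd _ _ at hw
  rw [tailProd_eq_mul] at hw
  rw [map_inv, hw, mul_inv_rev, mul_inv_rev, Equiv.Perm.mul_apply, ← zpow_neg,
    Equiv.Perm.mul_apply]
  congr 2
  exact inv_mem hfix

theorem IsAdmissible.lt_of_neg (h : IsAdmissible cs w m k i) {j : Fin m} (hj : i j < 0) :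
    k j < n := by
  have h₁ := (h.tailSum_mem j).1
  rw [tailSum_eq_add] at h₁
  have hjm : (j : ℕ) + 1 < m := by
    by_contra hge
    rw [tailSum_of_ge i (not_lt.1 hge)] at h₁
    omega
  exact (h.mono (a := j) (b := ⟨j + 1, hjm⟩) (Fin.lt_def.2 (by simp))).trans_le (h.le_n _)

theorem IsAdmissible.signedPerm_inv_lt_iff (h : IsAdmissible cs w m k i) (j : Fin m) :
    signedPerm cs w⁻¹ (k j + 1) < signedPerm cs w⁻¹ (k j) ↔ i j < 0 := by
  have hmono := h.strictMonoOn j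
  obtain ⟨hp, hpk⟩ := h.tailSum_succ_mem j
  obtain ⟨hq, hqk⟩ := h.tailSum_mem j
  rw [tailSum_eq_add] at hq hqk
  have hk := h.one_le j
  have hne := h.ne_zero j
  have hlb := h.lb j
  have htop : (k j : ℤ) + 1 =
      (signedRot (k j + 1) ^ tailSum i (j + 1)) (k j + 1 - tailSum i (j + 1)) := by
    rw [signedRot_zpow_apply (by omega) (by omega) hp (by omega), if_pos (by omega)]
    omega
  rw [h.signedPerm_inv_apply j (by omega), h.signedPerm_inv_apply j le_rfl,
    signedRot_zpow_of_gt (by omega)]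
  rcases lt_or_gt_of_ne hne with hneg | hpos
  · have : (signedRot (k j) ^ (-i j)) (k j) =
        (signedRot (k j + 1) ^ tailSum i (j + 1)) (k j + 1 - tailSum i (j + 1) - i j) := by
      rw [signedRot_zpow_apply (by omega) (by omega) (by omega) (by omega), if_neg (by omega),
        signedRot_zpow_apply (by omega) (by omega) hp (by omega), if_neg (by omega)]
      omega
    rw [this, htop, iff_true_right hneg]
    exact hmono ⟨by omega, by omega⟩ ⟨by omega, by omega⟩ (by omega)
  · have : (signedRot (k j) ^ (-i j)) (k j) =
        (signedRot (k j + 1) ^ tailSum i (j + 1)) (k j - i j - tailSum i (j + 1)) := by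
      rw [zpow_neg, Equiv.Perm.inv_eq_iff_eq,
        signedRot_zpow_apply (x := k j - i j - tailSum i (j + 1)) (by omega) (by omega) hp
          (by omega),
        if_pos (by omega), signedRot_zpow_apply (by omega) (by omega) (by omega) (by omega),
        if_pos (by omega)]
      omega
    rw [this, htop, iff_false_right (by omega), not_lt]
    exact (hmono ⟨by omega, by omega⟩ ⟨by omega, by omega⟩ (by omega)).le

end Admissible

/-- If `w` has an `Ṡ_n`-admissible presentation `w = τ_{k_1}^{i_{k_1}} ⋯ τ_{k_m}^{i_{k_m}}`,
then for every `j`, the index `k_j` is a left descent of `w` iff `i_{k_j} < 0`. -/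
theorem descent_iff_neg (cs : CoxeterSystem (BCoxeterMatrix n) W) (w : W)
    (m : ℕ) (k : Fin m → ℕ) (i : Fin m → ℤ) (h : IsAdmissible cs w m k i) :
    ∀ j : Fin m, IsDescentAt cs w (k j) ↔ i j < 0 := by
  intro j
  have hlow : lowEntry (k j) = k j := if_neg (by have := h.one_le j; omega)
  rw [← h.signedPerm_inv_lt_iff j]
  constructor
  · rintro ⟨hj, hdes⟩
    simpa [hlow] using (isLeftDescent_iff_signedPerm_lt cs).1 hdes
  · intro hlt
    refine ⟨h.lt_of_neg ((h.signedPerm_inv_lt_iff j).1 hlt), ?_⟩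
    rw [isLeftDescent_iff_signedPerm_lt]
    simpa [hlow] using hlt
end

section
/- Let 1 ≤ q ≤ n, let v = τ_q^{−q}, and let u ∈ W have an Ṡ_n-admissible presentation u = τ_{k_1}^{i_{k_1}}·τ_{k_2}^{i_{k_2}}⋯τ_{k_m}^{i_{k_m}} with k_1 ≥ q. Then the left descent set of v·u satisfies: (i) for every 0 ≤ j < q, j ∈ des(v·u) if and only if j ∉ des(u); (ii) q ∉ des(v·u); and (iii) for every q < j ≤ n−1, j ∈ des(v·u) if and only if j ∈ des(u). -/
variable {n : ℕ} {W : Type*} [Group W]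

namespace TypeB

/-- The value at `x` of the signed reflection exchanging `a` with `b` and `-a` with `-b`. -/
def signedSwap (a b x : ℤ) : ℤ :=
  if x = a then b else if x = b then a else if x = -a then -b else if x = -b then -a else x

theorem signedSwap_conj (g : ℤ ≃ ℤ) (hg : ∀ x, g (-x) = -g x) (a b x : ℤ) :
    g (signedSwap a b x) = signedSwap (g a) (g b) (g x) := by
  unfold signedSwap
  simp only [← hg, g.injective.eq_iff]
  split_ifs <;> rfl

/-- The smaller of the two points `-1, 1` (for `j = 0`) or `j, j + 1` (for `0 < j`). -/
def lowerPoint (j : ℕ) : ℤ := if j = 0 then -1 else j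

theorem signedSwap_lowerPoint_involutive (j : ℕ) :
    Function.Involutive (signedSwap (lowerPoint j) (j + 1)) := by
  intro x
  unfold signedSwap lowerPoint
  rcases j.eq_zero_or_pos with rfl | hj
  · simp only [if_true, Nat.cast_zero]
    grind
  · simp only [hj.ne', if_false]
    grind

/-- The action of the `j`-th simple reflection on signed points. -/
def simplePerm (j : ℕ) : Equiv.Perm ℤ :=
  (signedSwap_lowerPoint_involutive j).toPerm

theorem simplePerm_apply (j : ℕ) (x : ℤ) :
    simplePerm j x = signedSwap (lowerPoint j) (j + 1) x := rfl

theorem simplePerm_apply_apply (j : ℕ) (x : ℤ) : simplePerm j (simplePerm j x) = x :=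
  signedSwap_lowerPoint_involutive j x

theorem simplePerm_mul_self (j : ℕ) : simplePerm j * simplePerm j = 1 :=
  Equiv.ext (simplePerm_apply_apply j)

theorem simplePerm_neg (j : ℕ) (x : ℤ) : simplePerm j (-x) = -simplePerm j x := by
  simp only [simplePerm_apply]
  unfold signedSwap lowerPoint
  grind

theorem simplePerm_conj (i j : ℕ) (x : ℤ) :
    simplePerm i (simplePerm j x) =
      signedSwap (simplePerm i (lowerPoint j)) (simplePerm i (j + 1)) (simplePerm i x) :=
  signedSwap_conj _ (simplePerm_neg i) _ _ _

theorem simplePerm_comm {i j : ℕ} (h : i + 2 ≤ j) :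
    simplePerm i * simplePerm j = simplePerm j * simplePerm i := by
  have h1 : simplePerm i (lowerPoint j) = lowerPoint j := by
    rw [simplePerm_apply]
    unfold signedSwap lowerPoint
    grind
  have h2 : simplePerm i (j + 1) = j + 1 := by
    rw [simplePerm_apply]
    unfold signedSwap lowerPoint
    grind
  ext x
  rw [Equiv.Perm.mul_apply, simplePerm_conj, h1, h2]
  rfl

theorem simplePerm_braid {i : ℕ} (h : 1 ≤ i) :
    simplePerm i * simplePerm (i + 1) * simplePerm i =
      simplePerm (i + 1) * simplePerm i * simplePerm (i + 1) := by
  have h1 : simplePerm i (lowerPoint (i + 1)) = i := by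
    rw [simplePerm_apply]
    unfold signedSwap lowerPoint
    grind
  have h2 : simplePerm i ((i + 1 : ℕ) + 1) = i + 2 := by
    rw [simplePerm_apply]
    unfold signedSwap lowerPoint
    grind
  have h3 : simplePerm (i + 1) (lowerPoint i) = i := by
    rw [simplePerm_apply]
    unfold signedSwap lowerPoint
    grind
  have h4 : simplePerm (i + 1) (i + 1) = i + 2 := by
    rw [simplePerm_apply]
    unfold signedSwap lowerPoint
    grind
  ext x
  simp only [Equiv.Perm.mul_apply]
  rw [simplePerm_conj i (i + 1), simplePerm_apply_apply, h1, h2,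
    simplePerm_conj (i + 1) i, simplePerm_apply_apply, h3, h4]

theorem simplePerm_braid_zero :
    simplePerm 0 * simplePerm 1 * simplePerm 0 * simplePerm 1 =
      simplePerm 1 * simplePerm 0 * simplePerm 1 * simplePerm 0 := by
  ext x
  simp only [Equiv.Perm.mul_apply]
  rw [simplePerm_conj 0 1, simplePerm_conj 1 0]
  simp only [simplePerm_apply, lowerPoint]
  norm_num [signedSwap]
  grind

section Relations

variable {G : Type*} [Group G] {a b : G}

theorem mul_sq_eq_one_iff (ha : a * a = 1) (hb : b * b = 1) :
    (a * b) ^ 2 = 1 ↔ a * b = b * a := by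
  have ha' : a⁻¹ = a := inv_eq_of_mul_eq_one_left ha
  have hb' : b⁻¹ = b := inv_eq_of_mul_eq_one_left hb
  rw [pow_two, mul_eq_one_iff_eq_inv, mul_inv_rev, ha', hb']

theorem mul_pow_three_eq_one_iff (ha : a * a = 1) (hb : b * b = 1) :
    (a * b) ^ 3 = 1 ↔ a * b * a = b * a * b := by
  have ha' : a⁻¹ = a := inv_eq_of_mul_eq_one_left ha
  have hb' : b⁻¹ = b := inv_eq_of_mul_eq_one_left hb
  have : (a * b) ^ 3 = (a * b * a) * (b * a * b) := by
    simp only [pow_succ, pow_zero, one_mul, mul_assoc]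
  rw [this, mul_eq_one_iff_eq_inv]
  simp only [mul_inv_rev, ha', hb', mul_assoc]

theorem mul_pow_four_eq_one_iff (ha : a * a = 1) (hb : b * b = 1) :
    (a * b) ^ 4 = 1 ↔ a * b * a * b = b * a * b * a := by
  have ha' : a⁻¹ = a := inv_eq_of_mul_eq_one_left ha
  have hb' : b⁻¹ = b := inv_eq_of_mul_eq_one_left hb
  have : (a * b) ^ 4 = (a * b * a * b) * (a * b * a * b) := by
    simp only [pow_succ, pow_zero, one_mul, mul_assoc]
  rw [this, mul_eq_one_iff_eq_inv]
  simp only [mul_inv_rev, ha', hb', mul_assoc]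

end Relations

theorem isLiftable_simplePerm (n : ℕ) :
    (BCoxeterMatrix n).IsLiftable fun j : Fin n ↦ simplePerm j := by
  intro i j
  have hi := simplePerm_mul_self i
  have hj := simplePerm_mul_self j
  simp only [BCoxeterMatrix, Matrix.of_apply]
  split_ifs with h1 h2 h3
  · rw [pow_one, h1, hj]
  · rw [mul_pow_four_eq_one_iff hi hj]
    rcases h2 with ⟨h, h'⟩ | ⟨h, h'⟩
    · rw [h, h', simplePerm_braid_zero]
    · rw [h, h', simplePerm_braid_zero]
  · rw [mul_pow_three_eq_one_iff hi hj]
    rcases h3 with h | h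
    · rw [← h, simplePerm_braid (by omega)]
    · rw [← h, simplePerm_braid (by omega)]
  · rw [mul_sq_eq_one_iff hi hj]
    have : (i : ℕ) ≠ j := fun h ↦ h1 (Fin.ext h)
    rcases lt_or_ge (i : ℕ) j with h | h
    · exact simplePerm_comm (by omega)
    · exact (simplePerm_comm (by omega)).symm

/-- The action of `W` on signed points. -/
def signedPerm (cs : CoxeterSystem (BCoxeterMatrix n) W) : W →* Equiv.Perm ℤ :=
  cs.lift ⟨_, isLiftable_simplePerm n⟩

theorem signedPerm_simple (cs : CoxeterSystem (BCoxeterMatrix n) W) (j : Fin n) :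
    signedPerm cs (cs.simple j) = simplePerm j :=
  cs.lift_apply_simple (isLiftable_simplePerm n) j

theorem signedPerm_sgen (cs : CoxeterSystem (BCoxeterMatrix n) W) {j : ℕ} (hj : j < n) :
    signedPerm cs (sgen cs j) = simplePerm j := by
  rw [sgen, dif_pos hj, signedPerm_simple]

theorem signedPerm_neg (cs : CoxeterSystem (BCoxeterMatrix n) W) (w : W) (x : ℤ) :
    signedPerm cs w (-x) = -signedPerm cs w x := by
  induction w using cs.simple_induction_left with
  | one => simp
  | mul_simple_left w j ih => simp [signedPerm_simple, ih, simplePerm_neg]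

theorem sgen_mul_self (cs : CoxeterSystem (BCoxeterMatrix n) W) (j : ℕ) :
    sgen cs j * sgen cs j = 1 := by
  unfold sgen
  split_ifs <;> simp

theorem sgen_comm (cs : CoxeterSystem (BCoxeterMatrix n) W) {i j : ℕ} (h : i + 2 ≤ j) :
    Commute (sgen cs i) (sgen cs j) := by
  by_cases hj : j < n
  · have hi : i < n := by omega
    have hM : BCoxeterMatrix n ⟨i, hi⟩ ⟨j, hj⟩ = 2 := by
      simp only [BCoxeterMatrix, Matrix.of_apply, Fin.mk.injEq]
      rw [if_neg (by omega), if_neg (by omega), if_neg (by omega)]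
    have := cs.simple_mul_simple_pow ⟨i, hi⟩ ⟨j, hj⟩
    rw [hM, mul_sq_eq_one_iff (by simp) (by simp)] at this
    rwa [sgen, sgen, dif_pos hi, dif_pos hj]
  · simp [sgen, hj]

theorem sgen_braid (cs : CoxeterSystem (BCoxeterMatrix n) W) {i : ℕ} (hi : 1 ≤ i)
    (hn : i + 1 < n) :
    sgen cs i * sgen cs (i + 1) * sgen cs i = sgen cs (i + 1) * sgen cs i * sgen cs (i + 1) := by
  have hi' : i < n := by omega
  have hM : BCoxeterMatrix n ⟨i, hi'⟩ ⟨i + 1, hn⟩ = 3 := by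
    simp only [BCoxeterMatrix, Matrix.of_apply, Fin.mk.injEq]
    rw [if_neg (by omega), if_neg (by omega), if_pos (by simp)]
  have := cs.simple_mul_simple_pow ⟨i, hi'⟩ ⟨i + 1, hn⟩
  rw [hM, mul_pow_three_eq_one_iff (by simp) (by simp)] at this
  rwa [sgen, sgen, dif_pos hi', dif_pos hn]

theorem sgen_braid_zero (cs : CoxeterSystem (BCoxeterMatrix n) W) (hn : 1 < n) :
    sgen cs 0 * sgen cs 1 * sgen cs 0 * sgen cs 1 =
      sgen cs 1 * sgen cs 0 * sgen cs 1 * sgen cs 0 := by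
  have hn' : 0 < n := by omega
  have hM : BCoxeterMatrix n ⟨0, hn'⟩ ⟨1, hn⟩ = 4 := by
    simp only [BCoxeterMatrix, Matrix.of_apply, Fin.mk.injEq]
    rw [if_neg (by omega), if_pos (by simp)]
  have := cs.simple_mul_simple_pow ⟨0, hn'⟩ ⟨1, hn⟩
  rw [hM, mul_pow_four_eq_one_iff (by simp) (by simp)] at this
  rwa [sgen, sgen, dif_pos hn', dif_pos hn]

/-- The product `s_i · s_{i+1} ⋯ s_{i+t-1}`. -/
def ascProd (cs : CoxeterSystem (BCoxeterMatrix n) W) (i : ℕ) : ℕ → W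
  | 0 => 1
  | t + 1 => sgen cs i * ascProd cs (i + 1) t

/-- The product `s_s ⋯ s_1 · s_0 · s_1 ⋯ s_k`. -/
def descAscProd (cs : CoxeterSystem (BCoxeterMatrix n) W) (k : ℕ) : ℕ → W
  | 0 => ascProd cs 0 (k + 1)
  | s + 1 => sgen cs (s + 1) * descAscProd cs k s

theorem sgen_mul_ascProd_of_lt (cs : CoxeterSystem (BCoxeterMatrix n) W) {i j : ℕ} (t : ℕ)
    (h : j + 2 ≤ i) : sgen cs j * ascProd cs i t = ascProd cs i t * sgen cs j := by
  induction t generalizing i with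
  | zero => simp [ascProd]
  | succ t ih =>
    rw [ascProd, ← mul_assoc, (sgen_comm cs h).eq, mul_assoc, ih (by omega), mul_assoc]

theorem sgen_succ_mul_ascProd (cs : CoxeterSystem (BCoxeterMatrix n) W) {i j t : ℕ}
    (hi : 1 ≤ i) (hij : i ≤ j) (hj : j + 1 < i + t) (hn : i + t ≤ n) :
    sgen cs (j + 1) * ascProd cs i t = ascProd cs i t * sgen cs j := by
  induction t generalizing i with
  | zero => omega
  | succ t ih =>
    rcases hij.eq_or_lt with rfl | hlt
    · obtain ⟨t, rfl⟩ : ∃ t', t = t' + 1 := ⟨t - 1, by omega⟩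
      simp only [ascProd]
      have hb := sgen_braid cs hi (by omega : i + 1 < n)
      have hc := sgen_mul_ascProd_of_lt cs t (by omega : i + 2 ≤ i + 1 + 1)
      simp only [mul_assoc] at hb ⊢
      rw [← hc]
      simp only [← mul_assoc] at hb ⊢
      rw [hb]
    · rw [ascProd, ← mul_assoc, ← (sgen_comm cs (by omega : i + 2 ≤ j + 1)).eq, mul_assoc,
        ih (by omega) (by omega) (by omega) (by omega), mul_assoc]

theorem sgen_succ_mul_descAscProd (cs : CoxeterSystem (BCoxeterMatrix n) W) {k s j : ℕ}
    (hk : k < n) (hs : s + 1 ≤ j) (hj : j < k) :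
    sgen cs (j + 1) * descAscProd cs k s = descAscProd cs k s * sgen cs j := by
  induction s with
  | zero =>
    rw [descAscProd, ascProd, ← mul_assoc, ← (sgen_comm cs (by omega : 0 + 2 ≤ j + 1)).eq, mul_assoc,
      sgen_succ_mul_ascProd cs (by omega) (by omega) (by omega) (by omega), mul_assoc]
  | succ s ih =>
    rw [descAscProd, ← mul_assoc, ← (sgen_comm cs (by omega : s + 1 + 2 ≤ j + 1)).eq, mul_assoc,
      ih (by omega), mul_assoc]

theorem sgen_mul_descAscProd_of_lt (cs : CoxeterSystem (BCoxeterMatrix n) W) {k s j : ℕ}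
    (hk : k < n) (hs : s ≤ k) (hj : j < s) :
    sgen cs j * descAscProd cs k s = descAscProd cs k s * sgen cs j := by
  induction s with
  | zero => omega
  | succ s ih =>
    rcases (Nat.lt_succ_iff.1 hj).eq_or_lt with rfl | hlt
    · rcases j with _ | j
      · obtain ⟨k, rfl⟩ : ∃ k', k = k' + 1 := ⟨k - 1, by omega⟩
        simp only [descAscProd, ascProd, zero_add]
        have hb := sgen_braid_zero cs (by omega : 1 < n)
        have hc := sgen_mul_ascProd_of_lt cs k (by omega : 0 + 2 ≤ 1 + 1)
        simp only [mul_assoc] at hb ⊢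
        rw [← hc]
        simp only [← mul_assoc] at hb ⊢
        rw [hb]
      · have hb := sgen_braid cs (by omega : 1 ≤ j + 1) (by omega : j + 1 + 1 < n)
        have hc := sgen_succ_mul_descAscProd cs hk (by omega : j + 1 ≤ j + 1) (by omega)
        simp only [descAscProd]
        simp only [mul_assoc] at hb ⊢
        rw [← hc]
        simp only [← mul_assoc] at hb ⊢
        rw [hb]
    · rw [descAscProd, ← mul_assoc, (sgen_comm cs (by omega : j + 2 ≤ s + 1)).eq, mul_assoc,
        ih (by omega) hlt, mul_assoc]

/-- The parabolic subgroup generated by `s_0, …, s_{k-1}`. -/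
def parabolic (cs : CoxeterSystem (BCoxeterMatrix n) W) (k : ℕ) : Subgroup W :=
  Subgroup.closure (sgen cs '' {j | j < k})

theorem sgen_mem_parabolic (cs : CoxeterSystem (BCoxeterMatrix n) W) {j k : ℕ} (h : j < k) :
    sgen cs j ∈ parabolic cs k :=
  Subgroup.subset_closure ⟨j, h, rfl⟩

/-- The representatives of the left cosets of `parabolic cs k` in `parabolic cs (k + 1)`. -/
def IsCosetRep (cs : CoxeterSystem (BCoxeterMatrix n) W) (k : ℕ) (c : W) : Prop :=
  (∃ i t, i + t = k + 1 ∧ c = ascProd cs i t) ∨ ∃ s ≤ k, c = descAscProd cs k s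

theorem sgen_mul_cosetRep (cs : CoxeterSystem (BCoxeterMatrix n) W) {k j : ℕ} (hk : k < n)
    (hj : j ≤ k) {c : W} (hc : IsCosetRep cs k c) :
    ∃ c', IsCosetRep cs k c' ∧ ∃ h ∈ parabolic cs k, sgen cs j * c = c' * h := by
  have stay : ∀ l < k, sgen cs j * c = c * sgen cs l →
      ∃ c', IsCosetRep cs k c' ∧ ∃ h ∈ parabolic cs k, sgen cs j * c = c' * h :=
    fun l hl h ↦ ⟨c, hc, _, sgen_mem_parabolic cs hl, h⟩
  have move : ∀ c', IsCosetRep cs k c' → sgen cs j * c = c' →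
      ∃ c', IsCosetRep cs k c' ∧ ∃ h ∈ parabolic cs k, sgen cs j * c = c' * h :=
    fun c' hc' h ↦ ⟨c', hc', 1, one_mem _, by rw [h, mul_one]⟩
  have cancel : ∀ w : W, ∀ l, sgen cs l * (sgen cs l * w) = w := fun w l ↦ by
    rw [← mul_assoc, sgen_mul_self, one_mul]
  have desc : ∀ s ≤ k, c = descAscProd cs k s →
      ∃ c', IsCosetRep cs k c' ∧ ∃ h ∈ parabolic cs k, sgen cs j * c = c' * h := by
    rintro s hs rfl
    rcases lt_trichotomy j s with h | rfl | h
    · exact stay j (by omega) (sgen_mul_descAscProd_of_lt cs hk hs h)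
    · rcases j with _ | j
      · exact move (ascProd cs 1 k) (.inl ⟨1, k, by omega, rfl⟩)
          (by rw [descAscProd, ascProd, cancel])
      · exact move (descAscProd cs k j) (.inr ⟨j, by omega, rfl⟩) (by rw [descAscProd, cancel])
    · obtain ⟨j, rfl⟩ : ∃ j', j = j' + 1 := ⟨j - 1, by omega⟩
      rcases (Nat.lt_succ_iff.1 h).eq_or_lt with rfl | h
      · exact move (descAscProd cs k (s + 1)) (.inr ⟨_, hj, rfl⟩) rfl
      · exact stay j (by omega) (sgen_succ_mul_descAscProd cs hk h (by omega))
  rcases hc with ⟨i, t, hit, rfl⟩ | ⟨s, hs, hc⟩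
  · rcases i with _ | i
    · obtain rfl : t = k + 1 := by omega
      exact desc 0 (by omega) rfl
    · rcases lt_trichotomy j i with h | rfl | h
      · exact stay j (by omega) (sgen_mul_ascProd_of_lt cs t (by omega))
      · exact move (ascProd cs j (t + 1)) (.inl ⟨j, t + 1, by omega, rfl⟩) rfl
      · rcases (Nat.succ_le_of_lt h).eq_or_lt with rfl | h
        · obtain ⟨t, rfl⟩ : ∃ t', t = t' + 1 := ⟨t - 1, by omega⟩
          exact move (ascProd cs (i + 1 + 1) t) (.inl ⟨_, _, by omega, rfl⟩)
            (by rw [ascProd, cancel])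
        · obtain ⟨j, rfl⟩ : ∃ j', j = j' + 1 := ⟨j - 1, by omega⟩
          exact stay j (by omega)
            (sgen_succ_mul_ascProd cs (by omega) (by omega) (by omega) (by omega))
  · exact desc s hs hc

theorem exists_cosetRep (cs : CoxeterSystem (BCoxeterMatrix n) W) {k : ℕ} (hk : k < n) {w : W}
    (hw : w ∈ parabolic cs (k + 1)) :
    ∃ c, IsCosetRep cs k c ∧ ∃ h ∈ parabolic cs k, w = c * h := by
  have step : ∀ j ≤ k, ∀ y, (∃ c, IsCosetRep cs k c ∧ ∃ h ∈ parabolic cs k, y = c * h) →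
      ∃ c, IsCosetRep cs k c ∧ ∃ h ∈ parabolic cs k, sgen cs j * y = c * h := by
    rintro j hj y ⟨c, hc, h, hh, rfl⟩
    obtain ⟨c', hc', h', hh', e⟩ := sgen_mul_cosetRep cs hk hj hc
    exact ⟨c', hc', h' * h, mul_mem hh' hh, by rw [← mul_assoc, e, mul_assoc]⟩
  induction hw using Subgroup.closure_induction_left with
  | one => exact ⟨1, .inl ⟨k + 1, 0, rfl, rfl⟩, 1, one_mem _, by simp⟩
  | mul_left x hx y _ ih =>
    obtain ⟨j, hj, rfl⟩ := hx
    exact step j (Nat.lt_succ_iff.1 hj) y ih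
  | inv_mul_cancel x hx y _ ih =>
    obtain ⟨j, hj, rfl⟩ := hx
    rw [inv_eq_of_mul_eq_one_left (sgen_mul_self cs j)]
    exact step j (Nat.lt_succ_iff.1 hj) y ih

theorem signedPerm_ascProd (cs : CoxeterSystem (BCoxeterMatrix n) W) {i t : ℕ} (hi : 1 ≤ i)
    (h : i + t ≤ n) : signedPerm cs (ascProd cs i t) (i + t : ℕ) = i := by
  induction t generalizing i with
  | zero => simp [ascProd]
  | succ t ih =>
    rw [ascProd, map_mul, Equiv.Perm.mul_apply, show i + (t + 1) = i + 1 + t by ring,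
      ih (by omega) (by omega), signedPerm_sgen cs (by omega), simplePerm_apply]
    unfold signedSwap lowerPoint
    grind

theorem signedPerm_descAscProd (cs : CoxeterSystem (BCoxeterMatrix n) W) {k s : ℕ} (hk : k < n)
    (hs : s ≤ k) : signedPerm cs (descAscProd cs k s) (k + 1 : ℕ) = -(s + 1) := by
  induction s with
  | zero =>
    rw [descAscProd, ascProd, map_mul, Equiv.Perm.mul_apply, show k + 1 = 0 + 1 + k by ring,
      signedPerm_ascProd cs (by omega) (by omega), signedPerm_sgen cs (by omega), simplePerm_apply]
    simp [signedSwap, lowerPoint]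
  | succ s ih =>
    rw [descAscProd, map_mul, Equiv.Perm.mul_apply, ih (by omega), signedPerm_sgen cs (by omega),
      simplePerm_apply]
    unfold signedSwap lowerPoint
    grind

theorem signedPerm_of_mem_parabolic (cs : CoxeterSystem (BCoxeterMatrix n) W) {k : ℕ} (hk : k < n)
    {w : W} (hw : w ∈ parabolic cs k) : signedPerm cs w (k + 1 : ℕ) = (k + 1 : ℕ) := by
  have key : parabolic cs k ≤
      (MulAction.stabilizer (Equiv.Perm ℤ) ((k + 1 : ℕ) : ℤ)).comap (signedPerm cs) := by
    refine (Subgroup.closure_le _).2 ?_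
    rintro _ ⟨j, hj, rfl⟩
    have hj : j < k := hj
    simp only [Subgroup.coe_comap, Set.mem_preimage, SetLike.mem_coe, MulAction.mem_stabilizer_iff,
      Equiv.Perm.smul_def]
    rw [signedPerm_sgen cs (by omega), simplePerm_apply]
    unfold signedSwap lowerPoint
    grind
  simpa using key hw

theorem eq_one_of_mem_parabolic (cs : CoxeterSystem (BCoxeterMatrix n) W) {k : ℕ} (hk : k ≤ n)
    {w : W} (hw : w ∈ parabolic cs k) (h1 : signedPerm cs w = 1) : w = 1 := by
  induction k generalizing w with
  | zero => simpa [parabolic] using hw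
  | succ k ih =>
    obtain ⟨c, hc, h, hh, rfl⟩ := exists_cosetRep cs hk hw
    have hfix : signedPerm cs c (k + 1 : ℕ) = (k + 1 : ℕ) := by
      have := congrArg (fun f : Equiv.Perm ℤ ↦ f (k + 1 : ℕ)) h1
      simpa only [map_mul, Equiv.Perm.mul_apply, signedPerm_of_mem_parabolic cs hk hh,
        Equiv.Perm.one_apply] using this
    suffices c = 1 by
      subst this
      rw [one_mul] at h1 ⊢
      exact ih (by omega) hh h1
    have hdesc : ∀ s ≤ k, c ≠ descAscProd cs k s := by
      rintro s hs rfl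
      rw [signedPerm_descAscProd cs hk hs] at hfix
      omega
    rcases hc with ⟨i, t, hit, rfl⟩ | ⟨s, hs, hc⟩
    · rcases i with _ | i
      · obtain rfl : t = k + 1 := by omega
        exact absurd rfl (hdesc 0 (by omega))
      · rw [← hit, signedPerm_ascProd cs (by omega) (by omega)] at hfix
        obtain rfl : t = 0 := by omega
        rfl
    · exact absurd hc (hdesc s hs)

theorem signedPerm_injective (cs : CoxeterSystem (BCoxeterMatrix n) W) :
    Function.Injective (signedPerm cs) := by
  refine (injective_iff_map_eq_one _).2 fun w hw ↦ eq_one_of_mem_parabolic cs le_rfl ?_ hw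
  have : (⊤ : Subgroup W) ≤ parabolic cs n := by
    rw [← cs.subgroup_closure_range_simple, Subgroup.closure_le]
    rintro _ ⟨j, rfl⟩
    simpa [sgen] using sgen_mem_parabolic cs j.2
  exact this (Subgroup.mem_top w)

theorem simplePerm_ne_zero (j : ℕ) {x : ℤ} (hx : x ≠ 0) : simplePerm j x ≠ 0 := by
  rw [simplePerm_apply]
  unfold signedSwap lowerPoint
  grind

theorem signedSwap_eq_simplePerm (j : ℕ) {a b : ℤ} (ha : a ≠ 0) (hb : b ≠ 0) (hab : a < b)
    (h : simplePerm j b < simplePerm j a) (x : ℤ) : signedSwap a b x = simplePerm j x := by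
  have key : (a = lowerPoint j ∧ b = j + 1) ∨ (a = -(j + 1) ∧ b = -lowerPoint j) := by
    rw [simplePerm_apply, simplePerm_apply] at h
    unfold signedSwap lowerPoint at *
    rcases j.eq_zero_or_pos with rfl | hj
    · simp only [if_true, Nat.cast_zero] at *
      grind
    · simp only [hj.ne', if_false] at *
      grind
  rcases key with ⟨rfl, rfl⟩ | ⟨rfl, rfl⟩
  · rfl
  · rw [simplePerm_apply]
    unfold signedSwap lowerPoint
    grind

theorem exists_shorter_word (cs : CoxeterSystem (BCoxeterMatrix n) W) (L : List (Fin n)) {a b : ℤ}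
    (ha : a ≠ 0) (hb : b ≠ 0) (hab : a < b)
    (h : signedPerm cs (cs.wordProd L)⁻¹ b < signedPerm cs (cs.wordProd L)⁻¹ a) :
    ∃ L' : List (Fin n), L'.length < L.length ∧
      ∀ x, signedPerm cs (cs.wordProd L') x = signedSwap a b (signedPerm cs (cs.wordProd L) x) := by
  induction L generalizing a b with
  | nil =>
    simp only [CoxeterSystem.wordProd_nil, inv_one, map_one, Equiv.Perm.one_apply] at h
    omega
  | cons i L ih =>
    simp only [CoxeterSystem.wordProd_cons, mul_inv_rev, CoxeterSystem.inv_simple, map_mul,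
      Equiv.Perm.mul_apply, signedPerm_simple] at h ⊢
    rcases lt_or_ge (simplePerm i b) (simplePerm i a) with hi | hi
    · refine ⟨L, by simp, fun x ↦ ?_⟩
      rw [signedSwap_eq_simplePerm i ha hb hab hi, simplePerm_apply_apply]
    · have hi' := lt_of_le_of_ne hi ((simplePerm i).injective.ne hab.ne)
      obtain ⟨L', hL', hx⟩ :=
        ih (simplePerm_ne_zero i ha) (simplePerm_ne_zero i hb) hi' h
      refine ⟨i :: L', by simpa using hL', fun x ↦ ?_⟩
      rw [CoxeterSystem.wordProd_cons, map_mul, Equiv.Perm.mul_apply, signedPerm_simple, hx,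
        signedSwap_conj _ (simplePerm_neg i), simplePerm_apply_apply, simplePerm_apply_apply]

theorem lowerPoint_ne_zero (j : ℕ) : lowerPoint j ≠ 0 := by
  unfold lowerPoint
  grind

theorem lowerPoint_lt (j : ℕ) : lowerPoint j < j + 1 := by
  unfold lowerPoint
  grind

theorem isLeftDescent_of_lt (cs : CoxeterSystem (BCoxeterMatrix n) W) (w : W) (j : Fin n)
    (h : signedPerm cs w⁻¹ (j + 1) < signedPerm cs w⁻¹ (lowerPoint j)) : cs.IsLeftDescent w j := by
  obtain ⟨L, hL, rfl⟩ := cs.exists_isReduced w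
  obtain ⟨L', hlen, hx⟩ := exists_shorter_word cs L (lowerPoint_ne_zero j) (by omega)
    (lowerPoint_lt j) h
  have : cs.simple j * cs.wordProd L = cs.wordProd L' := by
    refine signedPerm_injective cs (Equiv.ext fun x ↦ ?_)
    rw [hx, map_mul, Equiv.Perm.mul_apply, signedPerm_simple, simplePerm_apply]
  rw [CoxeterSystem.IsLeftDescent, this, hL.eq]
  exact (cs.length_wordProd_le L').trans_lt hlen

theorem isDescentAt_iff (cs : CoxeterSystem (BCoxeterMatrix n) W) (w : W) {j : ℕ} (hj : j < n) :
    IsDescentAt cs w j ↔ signedPerm cs w⁻¹ (j + 1) < signedPerm cs w⁻¹ (lowerPoint j) := by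
  refine ⟨?_, fun h ↦ ⟨hj, isLeftDescent_of_lt cs w ⟨j, hj⟩ h⟩⟩
  rintro ⟨_, hd⟩
  by_contra hlt
  have hlt' := lt_of_le_of_ne (not_lt.1 hlt) ((signedPerm cs w⁻¹).injective.ne (lowerPoint_lt j).ne)
  refine (cs.isLeftDescent_iff_not_isLeftDescent_mul.1 hd) (isLeftDescent_of_lt cs _ _ ?_)
  have h1 : simplePerm j (lowerPoint j) = j + 1 := by simp [simplePerm_apply, signedSwap]
  have h2 : simplePerm j (j + 1) = lowerPoint j := by rw [← h1, simplePerm_apply_apply]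
  simp only [mul_inv_rev, CoxeterSystem.inv_simple, map_mul, Equiv.Perm.mul_apply,
    signedPerm_simple, h1, h2]
  exact hlt'

theorem tau_succ (cs : CoxeterSystem (BCoxeterMatrix n) W) (k : ℕ) :
    tau cs (k + 1) = tau cs k * sgen cs k := by
  simp [tau, List.range_succ]

theorem signedPerm_tau (cs : CoxeterSystem (BCoxeterMatrix n) W) {k : ℕ} (hk1 : 1 ≤ k)
    (hkn : k ≤ n) (x : ℤ) :
    signedPerm cs (tau cs k) x =
      if 1 ≤ x ∧ x < k then x + 1 else if x = k then -1 else if x = -k then 1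
      else if -k < x ∧ x ≤ -1 then x - 1 else x := by
  induction k, hk1 using Nat.le_induction generalizing x with
  | base =>
    rw [tau_succ, show tau cs 0 = 1 from rfl, one_mul, signedPerm_sgen cs hkn, simplePerm_apply]
    unfold signedSwap lowerPoint
    grind
  | succ k hk ih =>
    rw [tau_succ, map_mul, Equiv.Perm.mul_apply, ih (by omega), signedPerm_sgen cs (by omega),
      simplePerm_apply]
    unfold signedSwap lowerPoint
    simp only [show k ≠ 0 by omega, if_false]
    grind

/-- The image of the positive points under `τ_k ^ σ`, for `0 ≤ σ ≤ k`. -/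
def IsShiftedPos (σ y : ℤ) : Prop := σ < y ∨ (-σ ≤ y ∧ y < 0)

theorem isShiftedPos_tau (cs : CoxeterSystem (BCoxeterMatrix n) W) {k : ℕ} (hkn : k ≤ n) {σ : ℤ}
    (h0 : 0 ≤ σ) (hσ : σ < k) (y : ℤ) :
    IsShiftedPos (σ + 1) (signedPerm cs (tau cs k) y) ↔ IsShiftedPos σ y := by
  rw [signedPerm_tau cs (by omega) hkn]
  unfold IsShiftedPos
  split_ifs <;> omega

theorem isShiftedPos_tau_pow (cs : CoxeterSystem (BCoxeterMatrix n) W) {k : ℕ} (hkn : k ≤ n) {σ : ℤ}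
    (h0 : 0 ≤ σ) (a : ℕ) (hσ : σ + a ≤ k) (y : ℤ) :
    IsShiftedPos (σ + a) (signedPerm cs (tau cs k ^ a) y) ↔ IsShiftedPos σ y := by
  induction a with
  | zero => simp
  | succ a ih =>
    rw [pow_succ', map_mul, Equiv.Perm.mul_apply, Nat.cast_succ, ← add_assoc,
      isShiftedPos_tau cs hkn (by omega) (by omega), ih (by omega)]

theorem isShiftedPos_tau_zpow (cs : CoxeterSystem (BCoxeterMatrix n) W) {k : ℕ} (hkn : k ≤ n)
    {σ i : ℤ} (h0 : 0 ≤ σ) (hσ : σ ≤ k) (h0' : 0 ≤ i + σ) (hσ' : i + σ ≤ k) (y : ℤ) :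
    IsShiftedPos (i + σ) (signedPerm cs (tau cs k ^ i) y) ↔ IsShiftedPos σ y := by
  obtain ⟨a, rfl | rfl⟩ := i.eq_nat_or_neg
  · rw [add_comm, zpow_natCast, isShiftedPos_tau_pow cs hkn h0 a (by omega)]
  · rw [← isShiftedPos_tau_pow cs hkn h0' a (by omega), ← Equiv.Perm.mul_apply, ← map_mul,
      ← zpow_natCast, ← zpow_add, add_neg_cancel, zpow_zero, map_one, Equiv.Perm.one_apply,
      show -(a : ℤ) + σ + a = σ by ring]

theorem tailSum_eq {m : ℕ} (i : Fin m → ℤ) {r : ℕ} (hr : r < m) :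
    ∑ j ∈ Finset.univ.filter (fun j : Fin m ↦ r ≤ (j : ℕ)), i j =
      i ⟨r, hr⟩ + ∑ j ∈ Finset.univ.filter (fun j : Fin m ↦ r + 1 ≤ (j : ℕ)), i j := by
  have : Finset.univ.filter (fun j : Fin m ↦ r ≤ (j : ℕ)) =
      insert ⟨r, hr⟩ (Finset.univ.filter (fun j : Fin m ↦ r + 1 ≤ (j : ℕ))) := by
    ext j
    simp only [Finset.mem_filter, Finset.mem_univ, true_and, Finset.mem_insert, Fin.ext_iff]
    omega
  rw [this, Finset.sum_insert (by simp)]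

theorem _root_.IsAdmissible.tailSum_bounds {cs : CoxeterSystem (BCoxeterMatrix n) W} {u : W} {m : ℕ}
    {k : Fin m → ℕ} {i : Fin m → ℤ} (h : IsAdmissible cs u m k i) {r : ℕ} (hr : r < m) :
    0 ≤ ∑ j ∈ Finset.univ.filter (fun j : Fin m ↦ r ≤ (j : ℕ)), i j ∧
      ∑ j ∈ Finset.univ.filter (fun j : Fin m ↦ r ≤ (j : ℕ)), i j ≤ k ⟨r, hr⟩ := by
  rcases r with _ | r
  · simp [h.total]
  · obtain ⟨h1, h2⟩ := h.partialSum (r + 1) (by omega) hr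
    refine ⟨h1, h2.trans ?_⟩
    exact_mod_cast h.mono.monotone (Fin.mk_le_mk.2 (by omega))

theorem _root_.IsAdmissible.tailSum_succ_bounds {cs : CoxeterSystem (BCoxeterMatrix n) W} {u : W} {m : ℕ}
    {k : Fin m → ℕ} {i : Fin m → ℤ} (h : IsAdmissible cs u m k i) {r : ℕ} (hr : r < m) :
    0 ≤ ∑ j ∈ Finset.univ.filter (fun j : Fin m ↦ r + 1 ≤ (j : ℕ)), i j ∧
      ∑ j ∈ Finset.univ.filter (fun j : Fin m ↦ r + 1 ≤ (j : ℕ)), i j ≤ k ⟨r, hr⟩ := by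
  by_cases hr' : r + 1 < m
  · simpa using h.partialSum (r + 1) (by omega) hr'
  · rw [Finset.filter_false_of_mem (by intro j _; omega)]
    simp

theorem _root_.IsAdmissible.isShiftedPos_drop {cs : CoxeterSystem (BCoxeterMatrix n) W} {u : W} {m : ℕ}
    {k : Fin m → ℕ} {i : Fin m → ℤ} (h : IsAdmissible cs u m k i) {r : ℕ} (hr : r ≤ m) (x : ℤ) :
    IsShiftedPos (∑ j ∈ Finset.univ.filter (fun j : Fin m ↦ r ≤ (j : ℕ)), i j)
      (signedPerm cs (((List.finRange m).drop r).map fun j ↦ tau cs (k j) ^ i j).prod x) ↔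
      0 < x := by
  induction hr using Nat.decreasingInduction with
  | self =>
    rw [Finset.filter_false_of_mem (by intro j _; omega), List.drop_of_length_le (by simp)]
    simp only [IsShiftedPos, Finset.sum_empty, List.map_nil, List.prod_nil, map_one,
      Equiv.Perm.one_apply]
    omega
  | of_succ r hr ih =>
    obtain ⟨h1, h2⟩ := h.tailSum_bounds hr
    obtain ⟨h3, h4⟩ := h.tailSum_succ_bounds hr
    rw [tailSum_eq i hr] at h1 h2
    rw [tailSum_eq i hr, List.drop_eq_getElem_cons (by simpa using hr), List.map_cons,
      List.prod_cons, List.getElem_finRange, map_mul, Equiv.Perm.mul_apply]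
    exact (isShiftedPos_tau_zpow cs (h.le_n _) h3 h4 h1 h2 _).trans ih

theorem _root_.IsAdmissible.signedPerm_pos_iff {cs : CoxeterSystem (BCoxeterMatrix n) W} {u : W} {m : ℕ}
    {k : Fin m → ℕ} {i : Fin m → ℤ} (h : IsAdmissible cs u m k i) (x : ℤ) :
    0 < signedPerm cs u x ↔ 0 < x := by
  have := h.isShiftedPos_drop (Nat.zero_le m) x
  simp only [Nat.zero_le, Finset.filter_true, h.total, List.drop_zero, ← h.prod_eq,
    IsShiftedPos] at this
  omega

theorem signedPerm_tau_pow_of_le (cs : CoxeterSystem (BCoxeterMatrix n) W) {q : ℕ} (hqn : q ≤ n)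
    (a : ℕ) {x : ℤ} (hx : 1 ≤ x) (hxa : x + a ≤ q) :
    signedPerm cs (tau cs q ^ a) x = x + a := by
  induction a with
  | zero => simp
  | succ a ih =>
    rw [pow_succ', map_mul, Equiv.Perm.mul_apply, ih (by omega), signedPerm_tau cs (by omega) hqn,
      if_pos (by omega)]
    push_cast
    ring

theorem signedPerm_tau_pow_self (cs : CoxeterSystem (BCoxeterMatrix n) W) {q : ℕ} (hqn : q ≤ n)
    {x : ℤ} (hx : 1 ≤ x) (hxq : x ≤ q) : signedPerm cs (tau cs q ^ q) x = -x := by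
  lift x to ℕ using by omega
  have hexp : q = (x - 1) + (1 + (q - x)) := by omega
  have hmid : signedPerm cs (tau cs q ^ (1 + (q - x))) x = -1 := by
    rw [pow_add, pow_one, map_mul, Equiv.Perm.mul_apply,
      signedPerm_tau_pow_of_le cs hqn _ hx (by omega), signedPerm_tau cs (by omega) hqn,
      if_neg (by omega), if_pos (by omega)]
  rw [show tau cs q ^ q = tau cs q ^ (x - 1) * tau cs q ^ (1 + (q - x)) by rw [← pow_add, ← hexp],
    map_mul, Equiv.Perm.mul_apply, hmid, signedPerm_neg,
    signedPerm_tau_pow_of_le cs hqn _ le_rfl (by omega)]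
  omega

theorem signedPerm_tau_pow_of_lt (cs : CoxeterSystem (BCoxeterMatrix n) W) {q : ℕ} (hq1 : 1 ≤ q)
    (hqn : q ≤ n) (a : ℕ) {x : ℤ} (hx : q < x) : signedPerm cs (tau cs q ^ a) x = x := by
  induction a with
  | zero => simp
  | succ a ih =>
    rw [pow_succ', map_mul, Equiv.Perm.mul_apply, ih, signedPerm_tau cs hq1 hqn]
    split_ifs <;> omega

end TypeB

/-- Descents of `v·u` for `v = τ_q^{-q}` and `u` with an `Ṡ_n`-admissible
presentation with `k_1 ≥ q`: for `j < q`, `j ∈ des(v·u) ↔ j ∉ des(u)`;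
`q ∉ des(v·u)`; and for `q < j ≤ n-1`, `j ∈ des(v·u) ↔ j ∈ des(u)`. -/
theorem descents_v_mul_u (cs : CoxeterSystem (BCoxeterMatrix n) W)
    (q : ℕ) (hq1 : 1 ≤ q) (hqn : q ≤ n)
    (u : W) (m : ℕ) (k : Fin m → ℕ) (i : Fin m → ℤ)
    (h : IsAdmissible cs u m k i) (hm : 0 < m) (hk1 : q ≤ k ⟨0, hm⟩) :
    (∀ j : ℕ, j < q →
      (IsDescentAt cs (tau cs q ^ (-(q : ℤ)) * u) j ↔ ¬ IsDescentAt cs u j)) ∧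
    (¬ IsDescentAt cs (tau cs q ^ (-(q : ℤ)) * u) q) ∧
    (∀ j : ℕ, q < j → j ≤ n - 1 →
      (IsDescentAt cs (tau cs q ^ (-(q : ℤ)) * u) j ↔ IsDescentAt cs u j)) := by
  have hinv : (tau cs q ^ (-(q : ℤ)) * u)⁻¹ = u⁻¹ * tau cs q ^ q := by
    rw [mul_inv_rev, zpow_neg, inv_inv, zpow_natCast]
  have hpos : ∀ x, 0 < x → 0 < TypeB.signedPerm cs u⁻¹ x := fun x hx ↦ by
    rwa [← h.signedPerm_pos_iff, ← Equiv.Perm.mul_apply, ← map_mul, mul_inv_cancel, map_one,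
      Equiv.Perm.one_apply]
  have hodd := TypeB.signedPerm_neg cs u⁻¹
  have hoddτ := TypeB.signedPerm_neg cs (tau cs q ^ q)
  refine ⟨fun j hj ↦ ?_, ?_, fun j hj hjn ↦ ?_⟩
  · have hne := (TypeB.signedPerm cs u⁻¹).injective.ne (TypeB.lowerPoint_lt j).ne
    have hlow : TypeB.signedPerm cs (tau cs q ^ q) (TypeB.lowerPoint j) = -TypeB.lowerPoint j := by
      rcases j with _ | j
      · simp only [TypeB.lowerPoint, if_true]
        rw [hoddτ, TypeB.signedPerm_tau_pow_self cs hqn le_rfl (by omega)]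
      · simp only [TypeB.lowerPoint, Nat.succ_ne_zero, if_false]
        exact TypeB.signedPerm_tau_pow_self cs hqn (by omega) (by omega)
    rw [TypeB.isDescentAt_iff cs _ (by omega), TypeB.isDescentAt_iff cs _ (by omega), hinv, map_mul,
      Equiv.Perm.mul_apply, Equiv.Perm.mul_apply, hlow,
      TypeB.signedPerm_tau_pow_self cs hqn (by omega) (by omega), hodd, hodd]
    omega
  · intro hd
    obtain ⟨hq, -⟩ := id hd
    rw [TypeB.isDescentAt_iff cs _ hq, hinv, map_mul, Equiv.Perm.mul_apply, Equiv.Perm.mul_apply,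
      TypeB.signedPerm_tau_pow_of_lt cs hq1 hqn _ (by omega), TypeB.lowerPoint, if_neg (by omega),
      TypeB.signedPerm_tau_pow_self cs hqn (by omega) le_rfl, hodd] at hd
    have h1 := hpos (q + 1) (by omega)
    have h2 := hpos q (by omega)
    omega
  · rw [TypeB.isDescentAt_iff cs _ (by omega), TypeB.isDescentAt_iff cs _ (by omega), hinv, map_mul,
      Equiv.Perm.mul_apply, Equiv.Perm.mul_apply, TypeB.lowerPoint, if_neg (by omega),
      TypeB.signedPerm_tau_pow_of_lt cs hq1 hqn _ (by omega),
      TypeB.signedPerm_tau_pow_of_lt cs hq1 hqn _ (by omega)]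
end
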